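/- The quantum double of the even E6 system has exactly four normalized modular invariants: if Z is a 10×10 matrix with nonnegative integer entries such that Z_{00} = 1, ZS = SZ and ZT = TZ, then Z is one of Z1, Z2, Z3, Z4. -/

import Mathlib

open Matrix Complex

noncomputable section

/-- d = 1 + √3 -/
def dd : ℂ := 1 + Real.sqrt 3

/-- L = 2 + d² = 6 + 2√3 -/
def LL : ℂ := 6 + 2 * Real.sqrt 3

/-- The S-matrix of the modular data of the quantum double of the even E6 system. -/
def S : Matrix (Fin 10) (Fin 10) ℂ := LL⁻¹ •
  !![1,    1,    1+dd, 1+dd, 2+dd,  dd,   dd,    dd,          dd,          dd;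
     1,    1,    1+dd, 1+dd, -2-dd, dd,   dd,    -dd,         -dd,         -dd;
     1+dd, 1+dd, 1,    1,    2+dd,  -dd,  -dd,   -dd,         -dd,         -dd;
     1+dd, 1+dd, 1,    1,    -2-dd, -dd,  -dd,   dd,          dd,          dd;
     2+dd, -2-dd,2+dd, -2-dd,0,     0,    0,     0,           0,           0;
     dd,   dd,   -dd,  -dd,  0,     dd,   dd,    -dd,         -dd,         2*dd;
     dd,   dd,   -dd,  -dd,  0,     dd,   dd,    -dd,         -dd,         -2*dd;
     dd,   -dd,  -dd,  dd,   0,     -dd,  dd,    -(2+dd)*I,   (2+dd)*I,    0;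
     dd,   -dd,  -dd,  dd,   0,     -dd,  dd,    (2+dd)*I,    -(2+dd)*I,   0;
     dd,   -dd,  -dd,  dd,   0,     2*dd, -2*dd, 0,           0,           0]

/-- The T-matrix: diag(1,−1,1,−1,1,e^{πi/3},e^{4πi/3},e^{5πi/6},e^{5πi/6},−i). -/
def T : Matrix (Fin 10) (Fin 10) ℂ := Matrix.diagonal
  ![1, -1, 1, -1, 1,
    Complex.exp (Real.pi * I / 3), Complex.exp (4 * Real.pi * I / 3),
    Complex.exp (5 * Real.pi * I / 6), Complex.exp (5 * Real.pi * I / 6), -I]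

/-- Z1: the identity modular invariant. -/
def Z1 : Matrix (Fin 10) (Fin 10) ℂ := 1

/-- Z2: the permutation matrix of the transposition (7 8). -/
def Z2 : Matrix (Fin 10) (Fin 10) ℂ := Matrix.of fun μ ν =>
  if (μ = 7 ∧ ν = 8) ∨ (μ = 8 ∧ ν = 7) then 1
  else if μ = ν ∧ μ ≠ 7 ∧ μ ≠ 8 then 1 else 0

/-- Z3. -/
def Z3 : Matrix (Fin 10) (Fin 10) ℂ := Matrix.of fun μ ν =>
  if (μ = 0 ∨ μ = 2) ∧ (ν = 0 ∨ ν = 2) then 1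
  else if (μ = 1 ∨ μ = 3) ∧ (ν = 1 ∨ ν = 3) then 1
  else if μ = 4 ∧ ν = 4 then 2 else 0

/-- Z4. -/
def Z4 : Matrix (Fin 10) (Fin 10) ℂ := Matrix.of fun μ ν =>
  if (μ = 0 ∨ μ = 2 ∨ μ = 4) ∧ (ν = 0 ∨ ν = 2 ∨ ν = 4) then 1 else 0

/-- The part of `LL • S` free of `√3` and `I`. -/
def rationalPart : Matrix (Fin 10) (Fin 10) ℤ :=
  !![1, 1, 2, 2, 3, 1, 1, 1, 1, 1;
     1, 1, 2, 2, -3, 1, 1, -1, -1, -1;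
     2, 2, 1, 1, 3, -1, -1, -1, -1, -1;
     2, 2, 1, 1, -3, -1, -1, 1, 1, 1;
     3, -3, 3, -3, 0, 0, 0, 0, 0, 0;
     1, 1, -1, -1, 0, 1, 1, -1, -1, 2;
     1, 1, -1, -1, 0, 1, 1, -1, -1, -2;
     1, -1, -1, 1, 0, -1, 1, 0, 0, 0;
     1, -1, -1, 1, 0, -1, 1, 0, 0, 0;
     1, -1, -1, 1, 0, 2, -2, 0, 0, 0]

/-- The coefficient of `√3` in `LL • S`. -/
def sqrtPart : Matrix (Fin 10) (Fin 10) ℤ :=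
  !![0, 0, 1, 1, 1, 1, 1, 1, 1, 1;
     0, 0, 1, 1, -1, 1, 1, -1, -1, -1;
     1, 1, 0, 0, 1, -1, -1, -1, -1, -1;
     1, 1, 0, 0, -1, -1, -1, 1, 1, 1;
     1, -1, 1, -1, 0, 0, 0, 0, 0, 0;
     1, 1, -1, -1, 0, 1, 1, -1, -1, 2;
     1, 1, -1, -1, 0, 1, 1, -1, -1, -2;
     1, -1, -1, 1, 0, -1, 1, 0, 0, 0;
     1, -1, -1, 1, 0, -1, 1, 0, 0, 0;
     1, -1, -1, 1, 0, 2, -2, 0, 0, 0]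

/-- The coefficient of `(3 + √3) I` in `LL • S`. -/
def imagPart : Matrix (Fin 10) (Fin 10) ℤ := Matrix.of fun i j =>
  if i = j ∧ (i = 7 ∨ i = 8) then -1
  else if (i = 7 ∧ j = 8) ∨ (i = 8 ∧ j = 7) then 1 else 0

theorem LL_ne_zero : LL ≠ 0 := by
  have h : (6 + 2 * Real.sqrt 3 : ℝ) ≠ 0 := by positivity
  rw [LL]
  exact_mod_cast h

theorem LL_smul_S : LL • S = rationalPart.map (Int.cast : ℤ → ℂ)
    + (Real.sqrt 3 : ℂ) • sqrtPart.map (Int.cast : ℤ → ℂ)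
    + ((3 + Real.sqrt 3) * I : ℂ) • imagPart.map (Int.cast : ℤ → ℂ) := by
  rw [S, smul_inv_smul₀ LL_ne_zero]
  ext i j
  fin_cases i <;> fin_cases j <;>
    simp [rationalPart, sqrtPart, imagPart, dd] <;> ring

theorem eq_zero_of_add_sqrt_three_mul_eq_zero {x y : ℤ}
    (h : (x : ℝ) + Real.sqrt 3 * y = 0) : x = 0 := by
  have hirr : Irrational (Real.sqrt 3) := by
    simpa using (by norm_num : Nat.Prime 3).irrational_sqrt
  by_cases hy : y = 0
  · simpa [hy] using h
  · have h' : Irrational ((x : ℝ) + Real.sqrt 3 * y) :=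
      (hirr.mul_intCast hy).intCast_add x
    rw [h] at h'
    exact absurd h' not_irrational_zero

/-- An integer matrix commuting with `S` commutes with the rational part of `S`. -/
theorem commute_rationalPart {N : Matrix (Fin 10) (Fin 10) ℤ}
    (h : N.map (Int.cast : ℤ → ℂ) * S = S * N.map (Int.cast : ℤ → ℂ)) :
    N * rationalPart = rationalPart * N := by
  have h' : N.map (Int.cast : ℤ → ℂ) * (LL • S) = (LL • S) * N.map (Int.cast : ℤ → ℂ) := by
    rw [Matrix.mul_smul, Matrix.smul_mul, h]
  have hmap (P Q : Matrix (Fin 10) (Fin 10) ℤ) : P.map (Int.cast : ℤ → ℂ) *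
      Q.map (Int.cast : ℤ → ℂ) = (P * Q).map (Int.cast : ℤ → ℂ) :=
    (Matrix.map_mul (f := Int.castRingHom ℂ)).symm
  rw [LL_smul_S] at h'
  simp only [Matrix.mul_add, Matrix.add_mul, Matrix.mul_smul, Matrix.smul_mul, hmap] at h'
  ext i j
  have hij := congrArg Complex.re (congrFun (congrFun h' i) j)
  simp at hij
  have := eq_zero_of_add_sqrt_three_mul_eq_zero
    (x := (N * rationalPart) i j - (rationalPart * N) i j)
    (y := (N * sqrtPart) i j - (sqrtPart * N) i j) (by push_cast; linarith)
  exact sub_eq_zero.mp this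

/-- The exponents expressing the diagonal entries of `T` as powers of `exp (2πi/12)`. -/
def spinExponent : Fin 10 → ℕ := ![0, 6, 0, 6, 0, 2, 8, 5, 5, 9]

theorem T_eq_diagonal_pow :
    T = Matrix.diagonal fun i => Complex.exp (2 * Real.pi * I / 12) ^ spinExponent i := by
  have h6 : (-1 : ℂ) = Complex.exp (2 * Real.pi * I / 12) ^ 6 := by
    rw [← Complex.exp_nat_mul, ← Complex.exp_pi_mul_I]
    congr 1; push_cast; ring
  have h3 : I = Complex.exp (2 * Real.pi * I / 12) ^ 3 := by
    refine Complex.exp_pi_div_two_mul_I.symm.trans ?_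
    rw [← Complex.exp_nat_mul]
    congr 1; push_cast; ring
  have h9 : -I = Complex.exp (2 * Real.pi * I / 12) ^ 9 := by
    rw [pow_add _ 6 3, ← h6, ← h3, neg_one_mul]
  rw [T]
  congr 1
  funext i
  fin_cases i <;> simp [spinExponent, -neg_mul]
  · exact h6
  · exact h6
  · rw [← Complex.exp_nat_mul]; congr 1; push_cast; ring
  · rw [← Complex.exp_nat_mul]; congr 1; push_cast; ring
  · rw [← Complex.exp_nat_mul]; congr 1; push_cast; ring
  · rw [← Complex.exp_nat_mul]; congr 1; push_cast; ring
  · exact h9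

/-- A matrix commuting with `T` is block diagonal with respect to the eigenspaces of `T`. -/
theorem apply_eq_zero_of_commute_T {Z : Matrix (Fin 10) (Fin 10) ℂ} (hT : Z * T = T * Z)
    {i j : Fin 10} (hij : spinExponent i ≠ spinExponent j) : Z i j = 0 := by
  have hlt : ∀ k, spinExponent k < 12 := by decide
  have hζ : IsPrimitiveRoot (Complex.exp (2 * Real.pi * I / 12)) 12 := by
    simpa using Complex.isPrimitiveRoot_exp 12 (by norm_num)
  have h := congrFun (congrFun hT i) j
  rw [T_eq_diagonal_pow, Matrix.mul_diagonal, Matrix.diagonal_mul, mul_comm] at h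
  by_contra hne
  exact hij (hζ.pow_inj (hlt j) (hlt i) (mul_right_cancel₀ hne h)).symm

/-- The general solution of the linear constraints on a normalized modular invariant. -/
def invariantFamily (a b c : ℤ) : Matrix (Fin 10) (Fin 10) ℤ :=
  !![1, 0, a, 0, b, 0, 0, 0, 0, 0;
     0, 1 - b, 0, a - b, 0, 0, 0, 0, 0, 0;
     a, 0, 1, 0, b, 0, 0, 0, 0, 0;
     0, a - b, 0, 1 - b, 0, 0, 0, 0, 0, 0;
     b, 0, b, 0, 1 + a - b, 0, 0, 0, 0, 0;
     0, 0, 0, 0, 0, 1 - a, 0, 0, 0, 0;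
     0, 0, 0, 0, 0, 0, 1 - a, 0, 0, 0;
     0, 0, 0, 0, 0, 0, 0, c, 1 - a - c, 0;
     0, 0, 0, 0, 0, 0, 0, 1 - a - c, c, 0;
     0, 0, 0, 0, 0, 0, 0, 0, 0, 1 - a]

theorem sum_univ_ten {M : Type*} [AddCommMonoid M] (f : Fin 10 → M) :
    ∑ i, f i = f 0 + f 1 + f 2 + f 3 + f 4 + f 5 + f 6 + f 7 + f 8 + f 9 := by
  rw [Fin.sum_univ_castSucc, Fin.sum_univ_castSucc, Fin.sum_univ_eight]
  rfl

theorem eq_invariantFamily {N : Matrix (Fin 10) (Fin 10) ℤ} (h00 : N 0 0 = 1)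
    (hblock : ∀ i j, spinExponent i ≠ spinExponent j → N i j = 0)
    (hN : N * rationalPart = rationalPart * N) :
    N = invariantFamily (N 0 2) (N 0 4) (N 7 7) := by
  have hrow (i j : Fin 10) := congrFun (congrFun hN i) j
  simp only [Matrix.mul_apply, sum_univ_ten] at hrow
  have h0 := And.intro (hrow 0 0) <| And.intro (hrow 0 1) <| And.intro (hrow 0 2) <|
    And.intro (hrow 0 3) (hrow 0 4)
  have h0' := And.intro (hrow 0 5) <| And.intro (hrow 0 6) <| And.intro (hrow 0 7) <|
    And.intro (hrow 0 8) (hrow 0 9)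
  have h1 := And.intro (hrow 1 0) <| And.intro (hrow 1 1) <| And.intro (hrow 1 2) <|
    And.intro (hrow 1 3) (hrow 1 4)
  have h7 := hrow 7 0
  simp (disch := decide) [rationalPart, hblock, h00] at h0 h0' h1 h7
  obtain ⟨⟨h11, h13, h20, h22, h24, h31, h33, h40, h42, h44⟩, h55, h66, h78, h87, h88, h99⟩ :
      (N 1 1 = 1 - N 0 4 ∧ N 1 3 = N 0 2 - N 0 4 ∧ N 2 0 = N 0 2 ∧ N 2 2 = 1 ∧
      N 2 4 = N 0 4 ∧ N 3 1 = N 0 2 - N 0 4 ∧ N 3 3 = 1 - N 0 4 ∧ N 4 0 = N 0 4 ∧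
      N 4 2 = N 0 4 ∧ N 4 4 = 1 + N 0 2 - N 0 4) ∧ N 5 5 = 1 - N 0 2 ∧ N 6 6 = 1 - N 0 2 ∧
      N 7 8 = 1 - N 0 2 - N 7 7 ∧ N 8 7 = 1 - N 0 2 - N 7 7 ∧ N 8 8 = N 7 7 ∧
      N 9 9 = 1 - N 0 2 := by
    refine ⟨⟨?_, ?_, ?_, ?_, ?_, ?_, ?_, ?_, ?_, ?_⟩, ?_, ?_, ?_, ?_, ?_, ?_⟩ <;> linarith
  ext i j
  fin_cases i <;> fin_cases j <;> first | exact hblock _ _ (by decide) | assumption | rfl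

/-- The quantum double of the even E6 system has exactly four normalized modular
invariants: Z1, Z2, Z3, Z4. -/
theorem four_normalized_modular_invariants (Z : Matrix (Fin 10) (Fin 10) ℂ)
    (hint : ∀ μ ν : Fin 10, ∃ n : ℕ, Z μ ν = (n : ℂ))
    (hnorm : Z 0 0 = 1) (hS : Z * S = S * Z) (hT : Z * T = T * Z) :
    Z = Z1 ∨ Z = Z2 ∨ Z = Z3 ∨ Z = Z4 := by
  choose n hn using hint
  set N : Matrix (Fin 10) (Fin 10) ℤ := Matrix.of fun i j => (n i j : ℤ) with hNdef
  have hZ : Z = N.map (Int.cast : ℤ → ℂ) := by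
    ext i j
    simp [hNdef, hn]
  have hnonneg (i j : Fin 10) : 0 ≤ N i j := by simp [hNdef]
  have h00 : N 0 0 = 1 := by
    rw [hZ, Matrix.map_apply] at hnorm
    exact_mod_cast hnorm
  have hblock (i j : Fin 10) (hij : spinExponent i ≠ spinExponent j) : N i j = 0 := by
    have h := apply_eq_zero_of_commute_T hT hij
    rw [hZ, Matrix.map_apply] at h
    exact_mod_cast h
  have hfam := eq_invariantFamily h00 hblock (commute_rationalPart (hZ ▸ hS))
  have ha := hnonneg 0 2
  have hb := hnonneg 0 4
  have hc := hnonneg 7 7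
  have h13 := hnonneg 1 3
  have h78 := hnonneg 7 8
  generalize N 0 2 = a at *
  generalize N 0 4 = b at *
  generalize N 7 7 = c at *
  rw [hfam] at h13 h78 hZ
  simp [invariantFamily] at h13 h78
  have hcases : (a = 0 ∧ b = 0 ∧ c = 1) ∨ (a = 0 ∧ b = 0 ∧ c = 0) ∨
      (a = 1 ∧ b = 0 ∧ c = 0) ∨ (a = 1 ∧ b = 1 ∧ c = 0) := by omega
  rw [hZ]
  rcases hcases with ⟨rfl, rfl, rfl⟩ | ⟨rfl, rfl, rfl⟩ | ⟨rfl, rfl, rfl⟩ | ⟨rfl, rfl, rfl⟩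
  · left
    ext i j
    fin_cases i <;> fin_cases j <;> simp [invariantFamily, Z1]
  · right; left
    ext i j
    fin_cases i <;> fin_cases j <;> simp [invariantFamily, Z2]
  · right; right; left
    ext i j
    fin_cases i <;> fin_cases j <;> simp [invariantFamily, Z3]
  · right; right; right
    ext i j
    fin_cases i <;> fin_cases j <;> simp [invariantFamily, Z4]
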